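/- Let x ∈ D ⊆ 𝒟 with E_f(x) ∈ J satisfy ‖x − T(x)‖ ⪯ γ(E_f(x))·‖W_f(x)‖, where γ : J → ℝ₊ is such that ψ(t) = 1 − b·t·γ(t) is positive on J, and let μ(t) = 1 − t·γ(t). Then, writing x̂ = T(x) and σ̂_i(x) = Σ_{j≠i} W_j(x)/(x̂_i − x_j), one has for every i: |σ̂_i(x)| ≤ a·E_f(x)/μ(E_f(x)). (Theorem 2.1 (v)) -/

import Mathlib

open Finset Polynomial Filter

noncomputable section

/-- The Weierstrass correction `W_i(x) = f(x_i)/(C₀ ∏_{j≠i}(x_i − x_j))`. -/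
def Wc {n : ℕ} {K : Type*} [NormedField K] (f : Polynomial K) (x : Fin n → K) (i : Fin n) : K :=
  eval (x i) f / (f.leadingCoeff * ∏ j ∈ univ.erase i, (x i - x j))

/-- `dmin x i = min_{j ≠ i} ‖x i - x j‖`. -/
def dmin {n : ℕ} {K : Type*} [NormedField K] (x : Fin n → K) (i : Fin n) : ℝ :=
  if h : (univ.erase i).Nonempty then (univ.erase i).inf' h fun j => ‖x i - x j‖ else 0

/-- `E_f(x)` : the ℓ^p norm of the vector `(‖W_i(x)‖ / d_i(x))_i`. -/
def Ef {n : ℕ} {K : Type*} [NormedField K] (p : ENNReal) (f : Polynomial K)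
    (x : Fin n → K) : ℝ :=
  ‖(WithLp.equiv p (Fin n → ℝ)).symm (fun i => ‖Wc f x i‖ / dmin x i)‖

/-- `σ_i(x) = Σ_{j≠i} W_j(x)/(x_i − x_j)`. -/
def sigmaf {n : ℕ} {K : Type*} [NormedField K] (f : Polynomial K) (x : Fin n → K)
    (i : Fin n) : K :=
  ∑ j ∈ univ.erase i, Wc f x j / (x i - x j)

/-- The Ehrlich iteration function. -/
def PhiE {n : ℕ} {K : Type*} [NormedField K] (f : Polynomial K) (x : Fin n → K) : Fin n → K :=
  fun i => x i - Wc f x i / (1 + sigmaf f x i)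

/-- The Prešić–Tanabe iteration function. -/
def TnbE {n : ℕ} {K : Type*} [NormedField K] (f : Polynomial K) (x : Fin n → K) : Fin n → K :=
  fun i => x i - Wc f x i * (1 - sigmaf f x i)

/-- `ξ` is a root vector of `f`, i.e. `f(z) = C₀ ∏ (z − ξᵢ)`. -/
def IsRootVector {n : ℕ} {K : Type*} [NormedField K] (f : Polynomial K) (ξ : Fin n → K) : Prop :=
  f = C f.leadingCoeff * ∏ i, (X - C (ξ i))

/-- `E_f(x)` in the case `p = ∞`: the max of `‖W_i(x)‖ / d_i(x)`. -/
def Einf {n : ℕ} {K : Type*} [NormedField K] (f : Polynomial K) (x : Fin n → K) : ℝ :=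
  if h : (univ : Finset (Fin n)).Nonempty then univ.sup' h fun i => ‖Wc f x i‖ / dmin x i else 0

/-- Hölder's inequality on a finite set of coordinates of a vector of `ℓ^p`. -/
theorem PiLp.sum_norm_le_card_rpow_mul_norm {ι : Type*} [Fintype ι] {p : ENNReal} (hp : 1 ≤ p)
    (w : PiLp p fun _ : ι => ℝ) (s : Finset ι) :
    ∑ j ∈ s, ‖w j‖ ≤ (#s : ℝ) ^ (1 - (p⁻¹).toReal) * ‖w‖ := by
  have : Fact (1 ≤ p) := ⟨hp⟩
  rcases eq_or_ne p ⊤ with rfl | hp_top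
  · simpa using Finset.sum_le_card_nsmul s _ _ fun j _ => PiLp.norm_apply_le w j
  have hr : 1 ≤ p.toReal := by
    simpa using ENNReal.toReal_mono hp_top hp
  have hr0 : 0 < p.toReal := by linarith
  have hsum : 0 ≤ ∑ j ∈ s, ‖w j‖ := by positivity
  have hcard : (0 : ℝ) ≤ #s := by positivity
  have hpow := Real.rpow_sum_le_const_mul_sum_rpow s (fun j => w j) hr
  have hsub : ∑ j ∈ s, ‖w j‖ ^ p.toReal ≤ ∑ j, ‖w j‖ ^ p.toReal :=
    Finset.sum_le_sum_of_subset_of_nonneg (Finset.subset_univ s) fun _ _ _ => by positivity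
  have hle : (∑ j ∈ s, ‖w j‖) ^ p.toReal ≤
      (#s : ℝ) ^ (p.toReal - 1) * ∑ j, ‖w j‖ ^ p.toReal :=
    hpow.trans (mul_le_mul_of_nonneg_left hsub (by positivity))
  have hroot := Real.rpow_le_rpow (by positivity) hle (inv_nonneg.2 hr0.le)
  rw [Real.rpow_rpow_inv hsum hr0.ne', Real.mul_rpow (by positivity) (by positivity),
    ← Real.rpow_mul hcard] at hroot
  rw [PiLp.norm_eq_sum hr0, ENNReal.toReal_inv, one_div]
  convert hroot using 3
  field_simp

theorem dmin_le {n : ℕ} {K : Type*} [NormedField K] (x : Fin n → K) {i j : Fin n} (hij : j ≠ i) :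
    dmin x i ≤ ‖x i - x j‖ := by
  have hj : j ∈ univ.erase i := by simp [hij]
  have hne : (univ.erase i).Nonempty := ⟨j, hj⟩
  rw [dmin, dif_pos hne]
  exact Finset.inf'_le _ hj

theorem dmin_pos {n : ℕ} {K : Type*} [NormedField K] {x : Fin n → K} (hx : Function.Injective x)
    {i j : Fin n} (hij : j ≠ i) : 0 < dmin x i := by
  have hj : j ∈ univ.erase i := by simp [hij]
  have hne : (univ.erase i).Nonempty := ⟨j, hj⟩
  rw [dmin, dif_pos hne]
  refine (Finset.lt_inf'_iff _).2 fun k hk => ?_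
  exact norm_pos_iff.2 (sub_ne_zero.2 (hx.ne (Finset.ne_of_mem_erase hk).symm))

/-- Proinov, Theorem 2.1 (v). -/
theorem stmt_3 {n : ℕ} {K : Type*} [NormedField K] [CompleteSpace K] (hn : 2 ≤ n)
    (f : Polynomial K) (hdeg : f.degree = (n : ℕ))
    (p q : ENNReal) (hp : 1 ≤ p) (hpq : p⁻¹ + q⁻¹ = 1)
    (a b : ℝ) (ha : a = ((n : ℝ) - 1) ^ (ENNReal.toReal q⁻¹))
    (hb : b = (2 : ℝ) ^ (ENNReal.toReal q⁻¹))
    (J : Set ℝ) (hJ0 : (0 : ℝ) ∈ J) (hJsub : J ⊆ Set.Ici (0 : ℝ)) (hJconn : J.OrdConnected)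
    (γ : ℝ → ℝ) (hγ : ∀ t ∈ J, 0 ≤ γ t) (hψ : ∀ t ∈ J, 0 < 1 - b * t * γ t)
    (D : Set (Fin n → K)) (hD : ∀ y ∈ D, Function.Injective y)
    (T : (Fin n → K) → Fin n → K)
    (x : Fin n → K) (hxD : x ∈ D) (hxE : Ef p f x ∈ J)
    (hmain : ∀ i, ‖x i - T x i‖ ≤ γ (Ef p f x) * ‖Wc f x i‖) :
    ∀ i : Fin n,
      ‖∑ j ∈ univ.erase i, Wc f x j / (T x i - x j)‖ ≤
        a * Ef p f x / (1 - Ef p f x * γ (Ef p f x)) := by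
  intro i
  set E := Ef p f x
  set g := γ E
  have hE0 : 0 ≤ E := hJsub hxE
  have hg0 : 0 ≤ g := hγ E hxE
  have hx := hD x hxD
  have : Fact (1 ≤ p) := ⟨hp⟩
  have hb1 : 1 ≤ b := hb ▸ Real.one_le_rpow one_le_two ENNReal.toReal_nonneg
  have hμ : 0 < 1 - E * g := by
    nlinarith [hψ E hxE, mul_nonneg (sub_nonneg.2 hb1) (mul_nonneg hE0 hg0)]
  let w : PiLp p fun _ : Fin n => ℝ :=
    (WithLp.equiv p (Fin n → ℝ)).symm fun i => ‖Wc f x i‖ / dmin x i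
  have hwE : ‖w‖ = E := rfl
  have hexp : 1 - (p⁻¹).toReal = (q⁻¹).toReal := by
    have hp_inv : p⁻¹ ≠ ⊤ := ne_top_of_le_ne_top ENNReal.one_ne_top (hpq ▸ le_self_add)
    have hq_inv : q⁻¹ ≠ ⊤ := ne_top_of_le_ne_top ENNReal.one_ne_top (hpq ▸ le_add_self)
    have := congrArg ENNReal.toReal hpq
    rw [ENNReal.toReal_add hp_inv hq_inv, ENNReal.toReal_one] at this
    linarith
  have hterm : ∀ j ∈ univ.erase i, ‖Wc f x j / (T x i - x j)‖ ≤ ‖w j‖ / (1 - E * g) := by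
    intro j hj
    have hji := Finset.ne_of_mem_erase hj
    have hdi := dmin_pos hx hji
    have hdj := dmin_pos hx hji.symm
    have hdij := dmin_le x hji
    have hdji := dmin_le x hji.symm
    rw [norm_sub_rev] at hdji
    have hwi : ‖Wc f x i‖ ≤ E * dmin x i := by
      rw [← div_le_iff₀ hdi]
      exact (le_abs_self _).trans (hwE ▸ PiLp.norm_apply_le w i)
    have hmove : ‖x i - T x i‖ ≤ E * g * ‖x i - x j‖ := by
      calc ‖x i - T x i‖ ≤ g * ‖Wc f x i‖ := hmain i
        _ ≤ g * (E * ‖x i - x j‖) := by gcongr; exact hwi.trans (by gcongr)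
        _ = E * g * ‖x i - x j‖ := by ring
    have hsep : (1 - E * g) * ‖x i - x j‖ ≤ ‖T x i - x j‖ := by
      have := norm_sub_le_norm_sub_add_norm_sub (x i) (T x i) (x j)
      linarith
    have hwj : ‖w j‖ = ‖Wc f x j‖ / dmin x j := by
      rw [Real.norm_of_nonneg]
      · rfl
      · exact div_nonneg (norm_nonneg _) hdj.le
    have hden : (1 - E * g) * dmin x j ≤ ‖T x i - x j‖ :=
      (mul_le_mul_of_nonneg_left hdji hμ.le).trans hsep
    rw [norm_div, hwj, div_div, mul_comm (dmin x j)]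
    gcongr
  have hcard : ((#(univ.erase i) : ℕ) : ℝ) = (n : ℝ) - 1 := by
    rw [Finset.card_erase_of_mem (Finset.mem_univ i), Finset.card_univ, Fintype.card_fin,
      Nat.cast_sub (by lia), Nat.cast_one]
  calc ‖∑ j ∈ univ.erase i, Wc f x j / (T x i - x j)‖
      ≤ ∑ j ∈ univ.erase i, ‖w j‖ / (1 - E * g) := norm_sum_le_of_le _ hterm
    _ = (∑ j ∈ univ.erase i, ‖w j‖) / (1 - E * g) := (Finset.sum_div _ _ _).symm
    _ ≤ a * E / (1 - E * g) := by
      gcongr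
      simpa only [hcard, hexp, hwE, ha] using
        PiLp.sum_norm_le_card_rpow_mul_norm hp w (univ.erase i)
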